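/- arXiv:1708.08137 — 3 statements merged into one kernel-verified Lean document; each statement's English description precedes it below -/
import Mathlib

section
/- Let Z be an m×n real matrix, let U be an m×r real matrix and V an n×r real matrix with orthonormal columns (UᵀU = VᵀV = I_r), and let D be an r×r diagonal matrix with diagonal entries d_1 ≥ ... ≥ d_r > γ > 0. Suppose Z V = U D and Zᵀ U = V D (as holds for the leading r singular triplets of an SVD of Z). Then Ā = U (D − γ I_r)^{1/2} and B̄ = V (D − γ I_r)^{1/2} satisfy the first-order conditions (Z − Ā B̄ᵀ) B̄ = γ Ā and (Z − Ā B̄ᵀ)ᵀ Ā = γ B̄. -/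
open Matrix

/-- One half of the first-order conditions: if `V` has orthonormal columns and `Z V = U D` with
`D = diagonal d` and `d ≥ γ`, then `Z - U (D - γ I) Vᵀ`, factored through `(D - γ I)^{1/2}`, maps
`V (D - γ I)^{1/2}` to `γ U (D - γ I)^{1/2}`. -/
theorem sub_thresholded_mul_right {m n r : Type*} [Fintype n] [Fintype r] [DecidableEq r]
    {Z : Matrix m n ℝ} {U : Matrix m r ℝ} {V : Matrix n r ℝ} {d : r → ℝ} {γ : ℝ}
    (hV : Vᵀ * V = 1) (hd : ∀ i, γ ≤ d i) (hZV : Z * V = U * diagonal d) :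
    (Z - U * diagonal (fun i => Real.sqrt (d i - γ)) *
        (V * diagonal fun i => Real.sqrt (d i - γ))ᵀ) *
      (V * diagonal fun i => Real.sqrt (d i - γ)) =
      γ • (U * diagonal fun i => Real.sqrt (d i - γ)) := by
  set S : Matrix r r ℝ := diagonal fun i => Real.sqrt (d i - γ) with hS
  have hdiag : diagonal d * S - S * (S * S) = γ • S := by
    simp only [hS, diagonal_mul_diagonal, diagonal_sub, ← diagonal_smul]
    congr 1
    ext i
    simp only [Real.mul_self_sqrt (sub_nonneg.mpr (hd i)), Pi.smul_apply, smul_eq_mul]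
    ring
  have hST : Sᵀ = S := diagonal_transpose _
  calc (Z - U * S * (V * S)ᵀ) * (V * S)
      = Z * V * S - U * (S * (S * (Vᵀ * V * S))) := by
        simp only [transpose_mul, hST, Matrix.sub_mul, Matrix.mul_assoc]
    _ = U * (diagonal d * S - S * (S * S)) := by
        rw [hZV, hV, Matrix.one_mul, Matrix.mul_sub, Matrix.mul_assoc]
    _ = γ • (U * S) := by rw [hdiag, Matrix.mul_smul]

/-- If `U, V` have orthonormal columns, `D = diagonal d` with `d₁ ≥ ... ≥ d_r > γ > 0`, and
`Z V = U D`, `Zᵀ U = V D` (as for the leading `r` singular triplets of an SVD of `Z`), then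
`Ā = U (D − γ I)^{1/2}` and `B̄ = V (D − γ I)^{1/2}` satisfy the first-order conditions
`(Z − Ā B̄ᵀ) B̄ = γ Ā` and `(Z − Ā B̄ᵀ)ᵀ Ā = γ B̄`. -/
theorem thresholded_svd_satisfies_first_order_conditions {m n r : ℕ}
    (Z : Matrix (Fin m) (Fin n) ℝ) (γ : ℝ)
    (U : Matrix (Fin m) (Fin r) ℝ) (V : Matrix (Fin n) (Fin r) ℝ)
    (hU : Uᵀ * U = 1) (hV : Vᵀ * V = 1)
    (d : Fin r → ℝ)
    (hmono : ∀ i j : Fin r, i ≤ j → d j ≤ d i)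
    (hγ : 0 < γ) (hdγ : ∀ i, γ < d i)
    (hZV : Z * V = U * Matrix.diagonal d)
    (hZU : Zᵀ * U = V * Matrix.diagonal d) :
    let Abar := U * Matrix.diagonal fun i => Real.sqrt (d i - γ)
    let Bbar := V * Matrix.diagonal fun i => Real.sqrt (d i - γ)
    (Z - Abar * Bbarᵀ) * Bbar = γ • Abar ∧
      (Z - Abar * Bbarᵀ)ᵀ * Abar = γ • Bbar := by
  intro Abar Bbar
  refine ⟨sub_thresholded_mul_right hV (fun i => (hdγ i).le) hZV, ?_⟩
  rw [transpose_sub, transpose_mul, transpose_transpose]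
  exact sub_thresholded_mul_right hU (fun i => (hdγ i).le) hZU
end

section
/- Let Z be an m×n real matrix with full singular value decomposition Z = U D Vᵀ, where U is m×m orthogonal, V is n×n orthogonal, and D is m×n with diagonal entries d_1 ≥ d_2 ≥ ... ≥ d_{min(m,n)} ≥ 0 and zeros elsewhere. Fix r ≤ min(m,n) and γ > 0, let U_r and V_r denote the first r columns of U and V, and let D_r^γ be the r×r diagonal matrix with entries max(d_i − γ, 0) for i = 1,...,r. Then Ā = U_r (D_r^γ)^{1/2} and B̄ = V_r (D_r^γ)^{1/2} are global minimizers of the function (A, B) ↦ (1/2)‖Z − A Bᵀ‖_F² + (γ/2)(‖A‖_F² + ‖B‖_F²) over all m×r real matrices A and n×r real matrices B. -/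
open Matrix

/-- Frobenius norm of a real matrix: square root of the sum of squared entries. -/
noncomputable def frobNorm {m n : Type*} [Fintype m] [Fintype n] (M : Matrix m n ℝ) : ℝ :=
  Real.sqrt (∑ i, ∑ j, (M i j) ^ 2)

theorem frobNorm_sq {m n : Type*} [Fintype m] [Fintype n] (M : Matrix m n ℝ) :
    frobNorm M ^ 2 = ∑ i, ∑ j, (M i j) ^ 2 :=
  Real.sq_sqrt (Finset.sum_nonneg fun _ _ => Finset.sum_nonneg fun _ _ => sq_nonneg _)

theorem frobNorm_sq_eq_trace {m n : Type*} [Fintype m] [Fintype n] (M : Matrix m n ℝ) :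
    frobNorm M ^ 2 = (Mᵀ * M).trace := by
  rw [frobNorm_sq, Finset.sum_comm]
  simp [Matrix.trace, Matrix.mul_apply, sq]

theorem frobNorm_transpose {m n : Type*} [Fintype m] [Fintype n] (M : Matrix m n ℝ) :
    frobNorm Mᵀ = frobNorm M := by
  simp only [frobNorm, Matrix.transpose_apply]
  rw [Finset.sum_comm]

theorem frobNorm_orthogonal_mul_sq {m n : Type*} [Fintype m] [DecidableEq m] [Fintype n]
    {U : Matrix m m ℝ} (hU : Uᵀ * U = 1) (M : Matrix m n ℝ) :
    frobNorm (U * M) ^ 2 = frobNorm M ^ 2 := by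
  rw [frobNorm_sq_eq_trace, frobNorm_sq_eq_trace, Matrix.transpose_mul, Matrix.mul_assoc,
    ← Matrix.mul_assoc Uᵀ, hU, Matrix.one_mul]

theorem frobNorm_mul_orthogonal_transpose_sq {m n : Type*} [Fintype m] [Fintype n] [DecidableEq n]
    {V : Matrix n n ℝ} (hV : Vᵀ * V = 1) (M : Matrix m n ℝ) :
    frobNorm (M * Vᵀ) ^ 2 = frobNorm M ^ 2 := by
  rw [← frobNorm_transpose, Matrix.transpose_mul, Matrix.transpose_transpose,
    frobNorm_orthogonal_mul_sq hV, frobNorm_transpose]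

theorem frobNorm_sub_sq {m n : Type*} [Fintype m] [Fintype n] (M N : Matrix m n ℝ) :
    frobNorm (M - N) ^ 2 =
      frobNorm M ^ 2 - 2 * (∑ i, ∑ j, M i j * N i j) + frobNorm N ^ 2 := by
  simp only [frobNorm_sq, Finset.mul_sum, ← Finset.sum_sub_distrib, ← Finset.sum_add_distrib,
    Matrix.sub_apply]
  exact Finset.sum_congr rfl fun _ _ => Finset.sum_congr rfl fun _ _ => by ring

/-- The regularized factorization objective. -/
noncomputable def factorizationCost {m n r : Type*} [Fintype m] [Fintype n] [Fintype r]
    (γ : ℝ) (Z : Matrix m n ℝ) (A : Matrix m r ℝ) (B : Matrix n r ℝ) : ℝ :=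
  (1 / 2) * frobNorm (Z - A * Bᵀ) ^ 2 + (γ / 2) * (frobNorm A ^ 2 + frobNorm B ^ 2)

theorem factorizationCost_orthogonal {m n r : Type*} [Fintype m] [DecidableEq m] [Fintype n]
    [DecidableEq n] [Fintype r] {U : Matrix m m ℝ} {V : Matrix n n ℝ}
    (hU : Uᵀ * U = 1) (hV : Vᵀ * V = 1) (γ : ℝ) (D : Matrix m n ℝ)
    (A : Matrix m r ℝ) (B : Matrix n r ℝ) :
    factorizationCost γ (U * D * Vᵀ) (U * A) (V * B) = factorizationCost γ D A B := by
  have h : U * D * Vᵀ - U * A * (V * B)ᵀ = U * (D - A * Bᵀ) * Vᵀ := by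
    simp only [Matrix.transpose_mul, Matrix.mul_sub, Matrix.sub_mul, Matrix.mul_assoc]
  rw [factorizationCost, factorizationCost, h, frobNorm_mul_orthogonal_transpose_sq hV,
    frobNorm_orthogonal_mul_sq hU, frobNorm_orthogonal_mul_sq hU, frobNorm_orthogonal_mul_sq hV]

theorem Fin.sum_castLE_le {p m : ℕ} (h : p ≤ m) {g : Fin m → ℝ} (hg : ∀ i, 0 ≤ g i) :
    ∑ k : Fin p, g (Fin.castLE h k) ≤ ∑ i, g i := by
  calc ∑ k : Fin p, g (Fin.castLE h k) = ∑ i ∈ Finset.univ.map (Fin.castLEEmb h), g i :=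
        (Finset.sum_map Finset.univ (Fin.castLEEmb h) g).symm
    _ ≤ ∑ i, g i := Finset.sum_le_univ_sum_of_nonneg hg

theorem Fin.sum_sum_ite_eq {m n : ℕ} (d : ℕ → ℝ) (f : Fin m → Fin n → ℝ) :
    ∑ i : Fin m, ∑ j : Fin n, (if (i : ℕ) = (j : ℕ) then d i else 0) * f i j =
      ∑ k : Fin (min m n), d k * f (Fin.castLE (min_le_left m n) k)
        (Fin.castLE (min_le_right m n) k) := by
  rw [← Finset.sum_product']
  symm
  refine Finset.sum_of_injOn
    (fun k => (Fin.castLE (min_le_left m n) k, Fin.castLE (min_le_right m n) k)) ?_ ?_ ?_ ?_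
  · intro a _ b _ hab
    simpa [Fin.ext_iff] using hab
  · intro _ _
    simp
  · rintro ⟨i, j⟩ _ hij
    have hne : (i : ℕ) ≠ j := fun e => hij ⟨⟨i, by omega⟩, by simp, by
      ext
      · rfl
      · simpa using e⟩
    simp [hne]
  · intro k _
    simp

/-- A weighted sum with weights in `[0, 1]` of total mass at most `r` is at most the sum of the
`r` largest terms. -/
theorem Fin.sum_mul_le_sum_castLE {p r : ℕ} (hr : r ≤ p) {w : ℕ → ℝ}
    (hmono : ∀ k l, k ≤ l → l < p → w l ≤ w k) (hw : ∀ k < p, 0 ≤ w k) {q : Fin p → ℝ}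
    (hq0 : ∀ k, 0 ≤ q k) (hq1 : ∀ k, q k ≤ 1) (hq : ∑ k, q k ≤ r) :
    ∑ k : Fin p, w k * q k ≤ ∑ k : Fin r, w k := by
  obtain ⟨c, hc, hlt, hge⟩ : ∃ c : ℝ, 0 ≤ c ∧ (∀ k < r, c ≤ w k) ∧
      ∀ k, r ≤ k → k < p → w k ≤ c := by
    rcases hr.lt_or_eq with h | h
    · exact ⟨w r, hw r h, fun k hk => hmono k r hk.le h, fun k hk hkp => hmono r k hk hkp⟩
    · exact ⟨0, le_rfl, fun k hk => hw k (by omega), fun k _ _ => by omega⟩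
  have hsum (f : ℕ → ℝ) : ∑ k : Fin r, f k = ∑ k : Fin p, if (k : ℕ) < r then f k else 0 := by
    rw [Fin.sum_univ_eq_sum_range f, Fin.sum_univ_eq_sum_range fun k => if k < r then f k else 0,
      ← Finset.sum_filter]
    congr 1
    ext k
    simp only [Finset.mem_range, Finset.mem_filter]
    omega
  have hterm : ∑ k : Fin p, (w k - c) * (q k - if (k : ℕ) < r then 1 else 0) ≤ 0 := by
    refine Finset.sum_nonpos fun k _ => ?_
    split_ifs with h
    · nlinarith [hlt k h, hq1 k]
    · nlinarith [hge k (not_lt.1 h) k.2, hq0 k]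
  have hone : ∑ k : Fin p, (if (k : ℕ) < r then (1 : ℝ) else 0) = r := by
    rw [← hsum fun _ => 1]
    simp
  have hexp : ∑ k : Fin p, (w k - c) * (q k - if (k : ℕ) < r then 1 else 0) =
      (∑ k : Fin p, w k * q k) - (∑ k : Fin r, w k) - c * (∑ k, q k - r) := by
    rw [← hone, hsum, ← Finset.sum_sub_distrib, ← Finset.sum_sub_distrib, Finset.mul_sum,
      ← Finset.sum_sub_distrib]
    refine Finset.sum_congr rfl fun k _ => ?_
    split_ifs <;> ring
  nlinarith [mul_nonneg hc (sub_nonneg.2 hq)]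

theorem Submodule.sum_norm_starProjection_sq {ι E : Type*} [Fintype ι] [NormedAddCommGroup E]
    [InnerProductSpace ℝ E] [FiniteDimensional ℝ E] (b : OrthonormalBasis ι ℝ E)
    (W : Submodule ℝ E) :
    ∑ i, ‖W.starProjection (b i)‖ ^ 2 = Module.finrank ℝ W := by
  let c := stdOrthonormalBasis ℝ W
  have h (i : ι) : ‖W.starProjection (b i)‖ ^ 2 = ∑ t, inner ℝ (b i) (c t : E) ^ 2 := by
    rw [Submodule.starProjection_apply, ← Submodule.coe_norm, ← c.sum_sq_norm_inner_left]
    refine Finset.sum_congr rfl fun t _ => ?_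
    rw [Submodule.inner_orthogonalProjectionOnto_eq_of_mem_right, Real.norm_eq_abs, sq_abs]
  simp_rw [h]
  rw [Finset.sum_comm]
  have h' (t) : ∑ i, inner ℝ (b i) (c t : E) ^ 2 = 1 := by
    have := b.sum_sq_norm_inner_right (c t : E)
    rw [← Submodule.coe_norm, c.norm_eq_one] at this
    simpa [sq_abs] using this
  simp [h']

/-- A form of the Eckart-Young bound for a diagonal matrix. -/
theorem sum_diag_mul_le {m n r : ℕ} (hr : r ≤ min m n) {e : ℕ → ℝ}
    (hmono : ∀ k l, k ≤ l → l < min m n → e l ≤ e k) (he : ∀ k < min m n, 0 ≤ e k)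
    (A : Matrix (Fin m) (Fin r) ℝ) (B : Matrix (Fin n) (Fin r) ℝ) :
    ∑ k : Fin (min m n), e k * (A * Bᵀ) (Fin.castLE (min_le_left m n) k)
        (Fin.castLE (min_le_right m n) k) ≤
      (1 / 2) * ∑ k : Fin r, e k ^ 2 + (1 / 2) * frobNorm (A * Bᵀ) ^ 2 := by
  let b := EuclideanSpace.basisFun (Fin m) ℝ
  let a : Fin r → EuclideanSpace ℝ (Fin m) := fun t => WithLp.toLp 2 fun i => A i t
  let W := Submodule.span ℝ (Set.range a)
  let x : Fin n → EuclideanSpace ℝ (Fin m) := fun j => WithLp.toLp 2 fun i => (A * Bᵀ) i j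
  have hx (j) : x j ∈ W := by
    have : x j = ∑ t, B j t • a t := by
      ext i
      simp [x, a, Matrix.mul_apply, mul_comm]
    rw [this]
    exact W.sum_mem fun t _ => W.smul_mem _ (Submodule.subset_span ⟨t, rfl⟩)
  have hW : (Module.finrank ℝ W : ℝ) ≤ r := by
    exact_mod_cast (finrank_range_le_card a).trans_eq (Fintype.card_fin r)
  let q : Fin m → ℝ := fun i => ‖W.starProjection (b i)‖ ^ 2
  have hq1 (i) : q i ≤ 1 := by
    have h := W.norm_starProjection_apply_le (b i)
    rw [b.norm_eq_one] at h
    exact pow_le_one₀ (norm_nonneg _) h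
  have hq : ∑ k : Fin (min m n), q (Fin.castLE (min_le_left m n) k) ≤ r :=
    (Fin.sum_castLE_le _ fun i => sq_nonneg _).trans
      ((W.sum_norm_starProjection_sq b).trans_le hW)
  have hnorm : frobNorm (A * Bᵀ) ^ 2 = ∑ j, ‖x j‖ ^ 2 := by
    rw [frobNorm_sq, Finset.sum_comm]
    simp [x, EuclideanSpace.norm_sq_eq]
  have hterm (c : ℝ) (i : Fin m) (j : Fin n) :
      c * (A * Bᵀ) i j ≤ (1 / 2) * (c ^ 2 * q i) + (1 / 2) * ‖x j‖ ^ 2 := by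
    have h1 : (A * Bᵀ) i j = inner ℝ (W.starProjection (b i)) (x j) := by
      rw [Submodule.inner_starProjection_left_eq_right,
        Submodule.starProjection_eq_self_iff.2 (hx j)]
      simp [b, x, EuclideanSpace.inner_single_left]
    have h2 := norm_sub_sq_real (c • W.starProjection (b i)) (x j)
    rw [real_inner_smul_left, ← h1, norm_smul, mul_pow, Real.norm_eq_abs, sq_abs] at h2
    have h3 := sq_nonneg ‖c • W.starProjection (b i) - x j‖
    simp only [q]
    linarith
  calc _ ≤ ∑ k : Fin (min m n), ((1 / 2) * (e k ^ 2 * q (Fin.castLE (min_le_left m n) k)) +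
          (1 / 2) * ‖x (Fin.castLE (min_le_right m n) k)‖ ^ 2) :=
        Finset.sum_le_sum fun k _ => hterm _ _ _
    _ ≤ _ := by
      rw [Finset.sum_add_distrib, ← Finset.mul_sum, ← Finset.mul_sum, hnorm]
      gcongr
      · exact Fin.sum_mul_le_sum_castLE (w := fun k => e k ^ 2) hr
          (fun k l hkl hl => pow_le_pow_left₀ (he l hl) (hmono k l hkl hl) 2)
          (fun k _ => sq_nonneg _) (fun k => sq_nonneg _) (fun k => hq1 _) hq
      · exact Fin.sum_castLE_le (g := fun j => ‖x j‖ ^ 2) _ fun j => sq_nonneg _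

/-- Shrinking the weight of an inner product by `γ` pays for the ridge penalty. -/
theorem mul_sum_sub_penalty_le {r : Type*} [Fintype r] {c γ : ℝ} (hc : 0 ≤ c) (hγ : 0 ≤ γ)
    (a b : r → ℝ) :
    c * (∑ t, a t * b t) - (γ / 2) * (∑ t, a t ^ 2 + ∑ t, b t ^ 2) ≤
      max (c - γ) 0 * ∑ t, a t * b t := by
  have h : 2 * ∑ t, a t * b t ≤ ∑ t, a t ^ 2 + ∑ t, b t ^ 2 := by
    rw [Finset.mul_sum, ← Finset.sum_add_distrib]
    exact Finset.sum_le_sum fun t _ => by nlinarith [sq_nonneg (a t - b t)]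
  have h0 : 0 ≤ ∑ t, a t ^ 2 + ∑ t, b t ^ 2 := by positivity
  rcases le_total (c - γ) 0 with hcγ | hcγ
  · rw [max_eq_right hcγ]
    nlinarith
  · rw [max_eq_left hcγ]
    nlinarith

theorem factorizationCost_diag_ge {m n r : ℕ} (hr : r ≤ min m n) {d : ℕ → ℝ}
    (hmono : ∀ k l : ℕ, k ≤ l → l < min m n → d l ≤ d k)
    (hpos : ∀ k : ℕ, k < min m n → 0 ≤ d k) {D : Matrix (Fin m) (Fin n) ℝ}
    (hD : ∀ i j, D i j = if (i : ℕ) = (j : ℕ) then d (i : ℕ) else 0) {γ : ℝ} (hγ : 0 < γ)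
    (A : Matrix (Fin m) (Fin r) ℝ) (B : Matrix (Fin n) (Fin r) ℝ) :
    (1 / 2) * frobNorm D ^ 2 - (1 / 2) * ∑ k : Fin r, max (d k - γ) 0 ^ 2 ≤
      factorizationCost γ D A B := by
  let u := Fin.castLE (min_le_left m n)
  let v := Fin.castLE (min_le_right m n)
  have hinner : ∑ i, ∑ j, D i j * (A * Bᵀ) i j =
      ∑ k : Fin (min m n), d k * (A * Bᵀ) (u k) (v k) := by
    simp only [hD]
    exact Fin.sum_sum_ite_eq d _
  have hA : ∑ k, ∑ t, A (u k) t ^ 2 ≤ frobNorm A ^ 2 := by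
    rw [frobNorm_sq]
    exact Fin.sum_castLE_le (g := fun i => ∑ t, A i t ^ 2) _ fun i => by positivity
  have hB : ∑ k, ∑ t, B (v k) t ^ 2 ≤ frobNorm B ^ 2 := by
    rw [frobNorm_sq]
    exact Fin.sum_castLE_le (g := fun i => ∑ t, B i t ^ 2) _ fun i => by positivity
  have hshrink : ∑ k : Fin (min m n), d k * (A * Bᵀ) (u k) (v k) -
      (γ / 2) * (∑ k, ∑ t, A (u k) t ^ 2 + ∑ k, ∑ t, B (v k) t ^ 2) ≤
      ∑ k : Fin (min m n), max (d k - γ) 0 * (A * Bᵀ) (u k) (v k) := by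
    rw [← Finset.sum_add_distrib, Finset.mul_sum, ← Finset.sum_sub_distrib]
    exact Finset.sum_le_sum fun k _ =>
      mul_sum_sub_penalty_le (hpos k k.2) hγ.le (A (u k)) (B (v k))
  have hlow := sum_diag_mul_le (e := fun k => max (d k - γ) 0) hr
    (fun k l hkl hl => max_le_max_right 0 (sub_le_sub_right (hmono k l hkl hl) γ))
    (fun k _ => le_max_right _ _) A B
  rw [factorizationCost, frobNorm_sub_sq, hinner]
  have := mul_le_mul_of_nonneg_left (add_le_add hA hB) (half_pos hγ).le
  linarith

/-- The `m × r` matrix with diagonal `s` and zeros elsewhere. -/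
def rectDiagonal (m r : ℕ) (s : ℕ → ℝ) : Matrix (Fin m) (Fin r) ℝ :=
  Matrix.of fun i k => if (i : ℕ) = (k : ℕ) then s k else 0

theorem mul_rectDiagonal {m r : ℕ} (h : r ≤ m) (U : Matrix (Fin m) (Fin m) ℝ) (s : ℕ → ℝ) :
    U * rectDiagonal m r s =
      (Matrix.of fun i j => U i (Fin.castLE h j)) * Matrix.diagonal fun j : Fin r => s j := by
  ext i j
  rw [Matrix.mul_diagonal, Matrix.mul_apply, Finset.sum_eq_single (Fin.castLE h j)]
  · simp [rectDiagonal]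
  · intro k _ hk
    have : (k : ℕ) ≠ j := fun e => hk (Fin.ext e)
    simp [rectDiagonal, this]
  · simp

theorem sum_mul_rectDiagonal {m r : ℕ} (h : r ≤ m) (s : ℕ → ℝ) (f : Fin m → ℝ) (k : Fin r) :
    ∑ i, f i * rectDiagonal m r s i k = f (Fin.castLE h k) * s k := by
  rw [Finset.sum_eq_single (Fin.castLE h k)]
  · simp [rectDiagonal]
  · intro i _ hi
    have : (i : ℕ) ≠ k := fun e => hi (Fin.ext e)
    simp [rectDiagonal, this]
  · simp

theorem frobNorm_rectDiagonal_sq {m r : ℕ} (h : r ≤ m) (s : ℕ → ℝ) :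
    frobNorm (rectDiagonal m r s) ^ 2 = ∑ k : Fin r, s k ^ 2 := by
  rw [frobNorm_sq, Finset.sum_comm]
  refine Finset.sum_congr rfl fun k _ => ?_
  simp only [sq]
  rw [sum_mul_rectDiagonal h]
  simp [rectDiagonal]

theorem sum_mul_rectDiagonal_mul_transpose {m n r : ℕ} (hm : r ≤ m) (hn : r ≤ n) (s : ℕ → ℝ)
    (M : Matrix (Fin m) (Fin n) ℝ) :
    ∑ i, ∑ j, M i j * (rectDiagonal m r s * (rectDiagonal n r s)ᵀ) i j =
      ∑ k : Fin r, M (Fin.castLE hm k) (Fin.castLE hn k) * s k ^ 2 := by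
  have h (i) : ∑ j, M i j * (rectDiagonal m r s * (rectDiagonal n r s)ᵀ) i j =
      ∑ k : Fin r, (M i (Fin.castLE hn k) * s k) * rectDiagonal m r s i k := by
    simp only [Matrix.mul_apply, Matrix.transpose_apply, Finset.mul_sum]
    rw [Finset.sum_comm]
    refine Finset.sum_congr rfl fun k _ => ?_
    rw [← sum_mul_rectDiagonal hn s (M i) k, Finset.sum_mul]
    exact Finset.sum_congr rfl fun j _ => by ring
  simp only [h]
  rw [Finset.sum_comm]
  refine Finset.sum_congr rfl fun k _ => ?_
  rw [sum_mul_rectDiagonal hm s fun i => M i (Fin.castLE hn k) * s k]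
  ring

theorem rectDiagonal_mul_transpose_castLE {m n r : ℕ} (hm : r ≤ m) (hn : r ≤ n) (s : ℕ → ℝ)
    (k : Fin r) : (rectDiagonal m r s * (rectDiagonal n r s)ᵀ) (Fin.castLE hm k)
      (Fin.castLE hn k) = s k ^ 2 := by
  rw [Matrix.mul_apply, Finset.sum_eq_single k]
  · simp [rectDiagonal, sq]
  · intro t _ ht
    have : (k : ℕ) ≠ t := fun e => ht (Fin.ext e.symm)
    simp [rectDiagonal, this]
  · simp

theorem frobNorm_rectDiagonal_mul_transpose_sq {m n r : ℕ} (hm : r ≤ m) (hn : r ≤ n)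
    (s : ℕ → ℝ) : frobNorm (rectDiagonal m r s * (rectDiagonal n r s)ᵀ) ^ 2 =
      ∑ k : Fin r, s k ^ 2 * s k ^ 2 := by
  rw [frobNorm_sq]
  simp only [sq ((_ : Matrix (Fin m) (Fin n) ℝ) _ _)]
  rw [sum_mul_rectDiagonal_mul_transpose hm hn]
  simp only [rectDiagonal_mul_transpose_castLE]

theorem factorizationCost_diag_softThreshold {m n r : ℕ} (hr : r ≤ min m n) {d : ℕ → ℝ}
    {D : Matrix (Fin m) (Fin n) ℝ}
    (hD : ∀ i j, D i j = if (i : ℕ) = (j : ℕ) then d (i : ℕ) else 0) (γ : ℝ) :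
    factorizationCost γ D (rectDiagonal m r fun k => Real.sqrt (max (d k - γ) 0))
        (rectDiagonal n r fun k => Real.sqrt (max (d k - γ) 0)) =
      (1 / 2) * frobNorm D ^ 2 - (1 / 2) * ∑ k : Fin r, max (d k - γ) 0 ^ 2 := by
  have hm := hr.trans (min_le_left m n)
  have hn := hr.trans (min_le_right m n)
  have hs (k : ℕ) : Real.sqrt (max (d k - γ) 0) ^ 2 = max (d k - γ) 0 :=
    Real.sq_sqrt (le_max_right _ _)
  rw [factorizationCost, frobNorm_sub_sq, frobNorm_rectDiagonal_sq hm,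
    frobNorm_rectDiagonal_sq hn, sum_mul_rectDiagonal_mul_transpose hm hn,
    frobNorm_rectDiagonal_mul_transpose_sq hm hn]
  simp only [hs, hD, Fin.val_castLE, if_true]
  have key : ∑ k : Fin r, max (d k - γ) 0 ^ 2 =
      2 * ∑ k : Fin r, d k * max (d k - γ) 0 - ∑ k : Fin r, max (d k - γ) 0 * max (d k - γ) 0 -
        2 * γ * ∑ k : Fin r, max (d k - γ) 0 := by
    simp only [Finset.mul_sum, ← Finset.sum_sub_distrib]
    refine Finset.sum_congr rfl fun k _ => ?_
    rcases le_total (d k - γ) 0 with h | h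
    · simp [max_eq_right h]
    · rw [max_eq_left h]
      ring
  rw [key]
  ring

/-- Given a full SVD `Z = U D Vᵀ` with singular values `d₁ ≥ ... ≥ d_{min(m,n)} ≥ 0`, and
`γ > 0`, the soft-thresholded factors `Ā = U_r (D_r^γ)^{1/2}`, `B̄ = V_r (D_r^γ)^{1/2}`
(where `D_r^γ` has entries `max(dᵢ − γ, 0)`) globally minimize
`(A,B) ↦ (1/2)‖Z − A Bᵀ‖_F² + (γ/2)(‖A‖_F² + ‖B‖_F²)`. -/
theorem svt_minimizes_regularized_factorization {m n r : ℕ} (hr : r ≤ min m n)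
    (Z : Matrix (Fin m) (Fin n) ℝ)
    (U : Matrix (Fin m) (Fin m) ℝ) (V : Matrix (Fin n) (Fin n) ℝ)
    (hU : Uᵀ * U = 1) (hV : Vᵀ * V = 1)
    (d : ℕ → ℝ)
    (hmono : ∀ k l : ℕ, k ≤ l → l < min m n → d l ≤ d k)
    (hpos : ∀ k : ℕ, k < min m n → 0 ≤ d k)
    (D : Matrix (Fin m) (Fin n) ℝ)
    (hD : ∀ i j, D i j = if (i : ℕ) = (j : ℕ) then d (i : ℕ) else 0)
    (hZ : Z = U * D * Vᵀ)
    (γ : ℝ) (hγ : 0 < γ) :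
    let Ur : Matrix (Fin m) (Fin r) ℝ :=
      Matrix.of fun i j => U i (Fin.castLE (hr.trans (min_le_left m n)) j)
    let Vr : Matrix (Fin n) (Fin r) ℝ :=
      Matrix.of fun i j => V i (Fin.castLE (hr.trans (min_le_right m n)) j)
    let Abar := Ur * Matrix.diagonal fun j : Fin r => Real.sqrt (max (d (j : ℕ) - γ) 0)
    let Bbar := Vr * Matrix.diagonal fun j : Fin r => Real.sqrt (max (d (j : ℕ) - γ) 0)
    ∀ (A : Matrix (Fin m) (Fin r) ℝ) (B : Matrix (Fin n) (Fin r) ℝ),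
      (1 / 2) * frobNorm (Z - Abar * Bbarᵀ) ^ 2 + (γ / 2) * (frobNorm Abar ^ 2 + frobNorm Bbar ^ 2)
        ≤ (1 / 2) * frobNorm (Z - A * Bᵀ) ^ 2 + (γ / 2) * (frobNorm A ^ 2 + frobNorm B ^ 2) := by
  intro Ur Vr Abar Bbar A B
  have hA : Abar = U * rectDiagonal m r fun k => Real.sqrt (max (d k - γ) 0) :=
    (mul_rectDiagonal (hr.trans (min_le_left m n)) U fun k =>
      Real.sqrt (max (d k - γ) 0)).symm
  have hB : Bbar = V * rectDiagonal n r fun k => Real.sqrt (max (d k - γ) 0) :=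
    (mul_rectDiagonal (hr.trans (min_le_right m n)) V fun k =>
      Real.sqrt (max (d k - γ) 0)).symm
  have hUA : U * (Uᵀ * A) = A := by
    rw [← Matrix.mul_assoc, mul_eq_one_comm.1 hU, Matrix.one_mul]
  have hVB : V * (Vᵀ * B) = B := by
    rw [← Matrix.mul_assoc, mul_eq_one_comm.1 hV, Matrix.one_mul]
  change factorizationCost γ Z Abar Bbar ≤ factorizationCost γ Z A B
  calc factorizationCost γ Z Abar Bbar
      = (1 / 2) * frobNorm D ^ 2 - (1 / 2) * ∑ k : Fin r, max (d k - γ) 0 ^ 2 := by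
        rw [hA, hB, hZ, factorizationCost_orthogonal hU hV,
          factorizationCost_diag_softThreshold hr hD]
    _ ≤ factorizationCost γ D (Uᵀ * A) (Vᵀ * B) :=
        factorizationCost_diag_ge hr hmono hpos hD hγ _ _
    _ = factorizationCost γ Z A B := by
        rw [← factorizationCost_orthogonal hU hV, hUA, hVB, hZ]
end

section
/- Let M be a p×q real matrix, y ∈ ℝ^p, γ > 0, φ ∈ ℝ^k, and let R be a k×q real matrix such that R (MᵀM + γ I_q)⁻¹ Rᵀ is invertible. Define the unconstrained ridge solution x₀ = (MᵀM + γ I_q)⁻¹ Mᵀ y and set x̄ = x₀ − (MᵀM + γ I_q)⁻¹ Rᵀ [R (MᵀM + γ I_q)⁻¹ Rᵀ]⁻¹ (R x₀ − φ). Then R x̄ = φ, and x̄ minimizes the function x ↦ (1/2)‖y − M x‖² + (γ/2)‖x‖² over the set {x ∈ ℝ^q : R x = φ}; that is, the ridge estimate satisfying the linear restrictions is obtained from the unrestricted ridge estimate by the stated correction. -/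
open Matrix

/-- Euclidean norm of a real vector: square root of the sum of squared coordinates. -/
noncomputable def euclNorm {k : ℕ} (v : Fin k → ℝ) : ℝ :=
  Real.sqrt (∑ i, (v i) ^ 2)

theorem euclNorm_sq {k : ℕ} (v : Fin k → ℝ) : euclNorm v ^ 2 = v ⬝ᵥ v := by
  rw [euclNorm, Real.sq_sqrt (Finset.sum_nonneg fun i _ => sq_nonneg (v i))]
  simp [dotProduct, sq]

theorem isUnit_det_transpose_mul_self_add_smul_one {p q : ℕ}
    (M : Matrix (Fin p) (Fin q) ℝ) {γ : ℝ} (hγ : 0 < γ) :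
    IsUnit (Mᵀ * M + γ • (1 : Matrix (Fin q) (Fin q) ℝ)).det := by
  have hM : (Mᵀ * M).PosSemidef := by
    simpa using Matrix.posSemidef_conjTranspose_mul_self M
  exact (Matrix.PosDef.posSemidef_add hM (Matrix.PosDef.one.smul hγ)).det_pos.ne'.isUnit

/-- A point satisfying the Lagrange condition minimizes the ridge objective over the
points with the same image under `R`. -/
theorem ridge_le_of_lagrange {p q k : ℕ} (M : Matrix (Fin p) (Fin q) ℝ) (y : Fin p → ℝ)
    {γ : ℝ} (hγ : 0 ≤ γ) (R : Matrix (Fin k) (Fin q) ℝ) (μ : Fin k → ℝ) {z x : Fin q → ℝ}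
    (hz : (Mᵀ * M + γ • (1 : Matrix (Fin q) (Fin q) ℝ)) *ᵥ z = Mᵀ *ᵥ y - Rᵀ *ᵥ μ)
    (hx : R *ᵥ x = R *ᵥ z) :
    (1 / 2) * euclNorm (y - M *ᵥ z) ^ 2 + (γ / 2) * euclNorm z ^ 2 ≤
      (1 / 2) * euclNorm (y - M *ᵥ x) ^ 2 + (γ / 2) * euclNorm x ^ 2 := by
  obtain ⟨d, rfl⟩ : ∃ d, x = z + d := ⟨x - z, by simp⟩
  have hd : R *ᵥ d = 0 := by simpa [mulVec_add] using hx
  have key := congrArg (fun v => d ⬝ᵥ v) hz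
  simp only [add_mulVec, smul_mulVec, one_mulVec, ← mulVec_mulVec, dotProduct_add,
    dotProduct_sub, dotProduct_smul, smul_eq_mul, dotProduct_mulVec, vecMul_transpose, hd,
    zero_dotProduct, sub_zero] at key
  rw [← dotProduct_mulVec] at key
  have hMd : 0 ≤ (M *ᵥ d) ⬝ᵥ (M *ᵥ d) := euclNorm_sq (M *ᵥ d) ▸ sq_nonneg _
  have hdd : 0 ≤ γ * (d ⬝ᵥ d) := mul_nonneg hγ (euclNorm_sq d ▸ sq_nonneg _)
  simp only [euclNorm_sq, mulVec_add, dotProduct_add, add_dotProduct, dotProduct_sub,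
    sub_dotProduct]
  rw [dotProduct_comm (M *ᵥ z) (M *ᵥ d), dotProduct_comm y (M *ᵥ d),
    dotProduct_comm y (M *ᵥ z), dotProduct_comm z d]
  linarith

/-- The ridge estimate satisfying linear restrictions `R x = φ` is obtained from the
unrestricted ridge estimate `x₀ = (MᵀM + γ I)⁻¹ Mᵀ y` by the correction
`x̄ = x₀ − (MᵀM + γ I)⁻¹ Rᵀ [R (MᵀM + γ I)⁻¹ Rᵀ]⁻¹ (R x₀ − φ)`: then `R x̄ = φ` and `x̄`
minimizes the ridge objective over `{x : R x = φ}`. -/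
theorem restricted_ridge_solution {p q k : ℕ}
    (M : Matrix (Fin p) (Fin q) ℝ) (y : Fin p → ℝ) (γ : ℝ) (hγ : 0 < γ)
    (φ : Fin k → ℝ) (R : Matrix (Fin k) (Fin q) ℝ)
    (hR : IsUnit (R * (Mᵀ * M + γ • (1 : Matrix (Fin q) (Fin q) ℝ))⁻¹ * Rᵀ)) :
    let G := (Mᵀ * M + γ • (1 : Matrix (Fin q) (Fin q) ℝ))⁻¹
    let x0 := G *ᵥ (Mᵀ *ᵥ y)
    let xbar := x0 - (G * Rᵀ * (R * G * Rᵀ)⁻¹) *ᵥ (R *ᵥ x0 - φ)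
    R *ᵥ xbar = φ ∧
    ∀ x : Fin q → ℝ, R *ᵥ x = φ →
      (1 / 2) * euclNorm (y - M *ᵥ xbar) ^ 2 + (γ / 2) * euclNorm xbar ^ 2 ≤
        (1 / 2) * euclNorm (y - M *ᵥ x) ^ 2 + (γ / 2) * euclNorm x ^ 2 := by
  intro G x0 xbar
  have hA := isUnit_det_transpose_mul_self_add_smul_one M hγ
  have hRG : IsUnit (R * G * Rᵀ).det := (Matrix.isUnit_iff_isUnit_det _).mp hR
  have hfeas : R *ᵥ xbar = φ := by
    simp only [xbar]
    rw [mulVec_sub, mulVec_mulVec (R *ᵥ x0 - φ), ← Matrix.mul_assoc, ← Matrix.mul_assoc,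
      Matrix.mul_nonsing_inv _ hRG, one_mulVec, sub_sub_cancel]
  refine ⟨hfeas, fun x hx => ridge_le_of_lagrange M y hγ.le R
    ((R * G * Rᵀ)⁻¹ *ᵥ (R *ᵥ x0 - φ)) ?_ (hx.trans hfeas.symm)⟩
  simp only [xbar]
  have hx0 : (Mᵀ * M + γ • (1 : Matrix (Fin q) (Fin q) ℝ)) *ᵥ x0 = Mᵀ *ᵥ y := by
    rw [mulVec_mulVec (Mᵀ *ᵥ y), Matrix.mul_nonsing_inv _ hA, one_mulVec]
  rw [mulVec_sub, hx0, mulVec_mulVec (R *ᵥ x0 - φ), Matrix.mul_assoc G,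
    Matrix.mul_nonsing_inv_cancel_left _ _ hA, mulVec_mulVec (R *ᵥ x0 - φ)]
end
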